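/- arXiv:1806.10973 — 8 statements merged into one kernel-verified Lean document; each statement's English description precedes it below -/
import Mathlib

section
/- Let N ≥ 2 and let ν : {2,…,N−1} → Fin 2 (an outcome string for the last N−2 qubits) contain at least one 1. The vector obtained from the N-qubit W state W_N by setting to zero all amplitudes on strings whose last N−2 coordinates differ from ν equals (1/√N)·(|00⟩ ⊗ |ν⟩) (the vector supported on the single string that is 00 on the first two coordinates and ν on the rest) if ν has exactly one coordinate equal to 1, and is the zero vector if ν has two or more coordinates equal to 1. Consequently, each single-1 outcome occurs with probability 1/N, the conditional post-measurement state of the first two qubits is then the product state |00⟩, and outcomes with two or more 1s have probability zero. -/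
open Finset

/-- The N-qubit W state: amplitude `1/√N` on strings with exactly one coordinate
equal to 1, and 0 otherwise. -/
noncomputable def Wstate (N : ℕ) (x : Fin N → Fin 2) : ℂ :=
  if (∑ i, (x i : ℕ)) = 1 then ((1 / Real.sqrt N : ℝ) : ℂ) else 0

/-- The N-qubit string which is 0 on the first two coordinates and agrees with
`ν` on the coordinates `i ≥ 2` (coordinate `i` of the string is `ν (i - 2)`). -/
def extendZero (N : ℕ) (ν : Fin (N - 2) → Fin 2) (j : Fin N) : Fin 2 :=
  if h : 2 ≤ (j : ℕ) then ν ⟨(j : ℕ) - 2, by have := j.isLt; omega⟩ else 0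

theorem extendZero_succ_succ {m : ℕ} (ν : Fin m → Fin 2) (k : Fin m) :
    extendZero (m + 2) ν k.succ.succ = ν k := by
  simp [extendZero]

theorem forall_two_le_eq_extendZero_iff {m : ℕ} (ν : Fin m → Fin 2) (x : Fin (m + 2) → Fin 2) :
    (∀ j : Fin (m + 2), 2 ≤ (j : ℕ) → x j = extendZero (m + 2) ν j) ↔
      ∀ k : Fin m, x k.succ.succ = ν k := by
  simp only [Fin.forall_fin_succ (n := m + 1), Fin.forall_fin_succ (n := m),
    extendZero_succ_succ]
  simp

theorem eq_extendZero_iff {m : ℕ} (ν : Fin m → Fin 2) (x : Fin (m + 2) → Fin 2) :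
    x = extendZero (m + 2) ν ↔
      (x 0 : ℕ) = 0 ∧ (x 1 : ℕ) = 0 ∧ ∀ k : Fin m, x k.succ.succ = ν k := by
  simp only [funext_iff, Fin.forall_fin_succ (n := m + 1), Fin.forall_fin_succ (n := m),
    extendZero_succ_succ]
  simp [extendZero]

/-- Projecting the W state onto the strings whose last N−2 coordinates equal a
string ν containing at least one 1 gives `(1/√N)·(|00⟩⊗|ν⟩)` if ν has exactly
one 1, and the zero vector if ν has two or more 1s. -/
theorem W_projected_nonzero_outcome (N : ℕ) (hN : 2 ≤ N)
    (ν : Fin (N - 2) → Fin 2) (hν : 1 ≤ ∑ i, (ν i : ℕ)) :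
    (fun x : Fin N → Fin 2 =>
        if ∀ j : Fin N, 2 ≤ (j : ℕ) → x j = extendZero N ν j then Wstate N x else 0)
      = if (∑ i, (ν i : ℕ)) = 1 then
          (fun x : Fin N → Fin 2 =>
            if x = extendZero N ν then ((1 / Real.sqrt N : ℝ) : ℂ) else 0)
        else 0 := by
  obtain ⟨m, rfl⟩ : ∃ m, N = m + 2 := ⟨N - 2, by omega⟩
  change Fin m → Fin 2 at ν
  change 1 ≤ ∑ i : Fin m, (ν i : ℕ) at hν
  change _ = if ∑ i : Fin m, (ν i : ℕ) = 1 then _ else 0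
  funext x
  simp only [forall_two_le_eq_extendZero_iff, eq_extendZero_iff, Wstate]
  by_cases hx : ∀ k : Fin m, x k.succ.succ = ν k
  · have hsum : ∑ i, (x i : ℕ) = x 0 + (x 1 + ∑ k, (ν k : ℕ)) := by
      simp [Fin.sum_univ_succ, hx]
    have hiff : ∑ i, (x i : ℕ) = 1 ↔
        ∑ k, (ν k : ℕ) = 1 ∧ (x 0 : ℕ) = 0 ∧ (x 1 : ℕ) = 0 := by omega
    rw [if_pos hx]
    by_cases h1 : ∑ k, (ν k : ℕ) = 1 <;> simp [hiff, h1, hx]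
  · by_cases h1 : ∑ k, (ν k : ℕ) = 1 <;> simp [h1, hx]
end

section
/- Let N ≥ 3 and 1 ≤ k ≤ N−2. Project the reduced state Tr_k |W_N⟩⟨W_N| (the partial trace of the N-qubit W state over k lost qubits) onto the all-zero string of its last N−k−2 coordinates and take the partial trace over those coordinates. The resulting two-qubit matrix equals (1/N)·(2|ψ⁺⟩⟨ψ⁺| + k|00⟩⟨00|); its trace is (2+k)/N, and the normalized conditional state is ω̃_k = (2/(2+k))|ψ⁺⟩⟨ψ⁺| + (k/(2+k))|00⟩⟨00|. -/
open Finset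

/-- The two-qubit maximally entangled state ψ⁺: amplitude 1/√2 on the strings
01 and 10 and 0 elsewhere. -/
noncomputable def psiPlus (a : Fin 2 → Fin 2) : ℂ :=
  if (a 0 = 0 ∧ a 1 = 1) ∨ (a 0 = 1 ∧ a 1 = 0) then ((1 / Real.sqrt 2 : ℝ) : ℂ) else 0

/-- The N-qubit W state, with the index set (Fin N → Fin 2) identified with
triples consisting of the first two qubits, the middle m = N−k−2 qubits, and
the last k qubits: amplitude `1/√N` on strings with exactly one 1 in total. -/
noncomputable def WstateTriple (N m k : ℕ)
    (a : Fin 2 → Fin 2) (z : Fin m → Fin 2) (c : Fin k → Fin 2) : ℂ :=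
  if (∑ i, (a i : ℕ)) + (∑ i, (z i : ℕ)) + (∑ i, (c i : ℕ)) = 1 then
    ((1 / Real.sqrt N : ℝ) : ℂ) else 0

/-- The number of ones in a bit string. -/
def bitWeight {m : ℕ} (x : Fin m → Fin 2) : ℕ := ∑ i, (x i : ℕ)

theorem bitWeight_eq_zero_iff {m : ℕ} (x : Fin m → Fin 2) : bitWeight x = 0 ↔ x = 0 := by
  simp [bitWeight, Finset.sum_eq_zero_iff, funext_iff]

theorem bitWeight_eq_one_iff {m : ℕ} (x : Fin m → Fin 2) :
    bitWeight x = 1 ↔ ∃ i, Pi.single i 1 = x := by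
  constructor
  · intro h
    obtain ⟨i, hi⟩ : ∃ i, x i ≠ 0 := by
      by_contra! h0
      rw [(bitWeight_eq_zero_iff x).2 (funext h0)] at h
      exact zero_ne_one h
    rw [bitWeight, ← Finset.add_sum_erase _ _ (Finset.mem_univ i)] at h
    have hi' : (x i : ℕ) = 1 := by omega
    have hrest : ∑ j ∈ Finset.univ.erase i, (x j : ℕ) = 0 := by omega
    rw [Finset.sum_eq_zero_iff] at hrest
    refine ⟨i, funext fun j => ?_⟩
    by_cases hj : j = i
    · subst hj
      simp [Fin.ext_iff, hi']
    · rw [Pi.single_eq_of_ne hj, Fin.ext_iff, hrest j (by simp [hj])]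
      rfl
  · rintro ⟨i, rfl⟩
    rw [bitWeight, Finset.sum_eq_single i] <;> simp +contextual

theorem card_bitWeight_eq_one (m : ℕ) :
    (Finset.univ.filter fun x : Fin m → Fin 2 => bitWeight x = 1).card = m := by
  have himage : (Finset.univ.filter fun x : Fin m → Fin 2 => bitWeight x = 1)
      = Finset.univ.image fun i : Fin m => (Pi.single i 1 : Fin m → Fin 2) := by
    ext x
    simp [bitWeight_eq_one_iff]
  rw [himage, Finset.card_image_of_injective, Finset.card_univ, Fintype.card_fin]
  intro i j hij
  by_contra hne
  have := congrFun hij i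
  simp [Pi.single_eq_of_ne hne] at this

theorem card_bitWeight_eq_zero (m : ℕ) :
    (Finset.univ.filter fun x : Fin m → Fin 2 => bitWeight x = 0).card = 1 := by
  simp [bitWeight_eq_zero_iff, Finset.filter_eq']

theorem ofReal_one_div_sqrt_mul_conj (n : ℕ) :
    ((1 / Real.sqrt n : ℝ) : ℂ) * (starRingEnd ℂ) ((1 / Real.sqrt n : ℝ) : ℂ)
      = 1 / (n : ℂ) := by
  rw [Complex.conj_ofReal, ← Complex.ofReal_mul, div_mul_div_comm, one_mul,
    Real.mul_self_sqrt n.cast_nonneg]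
  push_cast
  rfl

theorem psiPlus_eq (a : Fin 2 → Fin 2) :
    psiPlus a = if bitWeight a = 1 then ((1 / Real.sqrt (2 : ℕ) : ℝ) : ℂ) else 0 := by
  have h : ((a 0 = 0 ∧ a 1 = 1) ∨ (a 0 = 1 ∧ a 1 = 0)) ↔ bitWeight a = 1 := by
    simp only [bitWeight, Fin.sum_univ_two, Fin.ext_iff, Fin.val_zero, Fin.val_one]
    omega
  simp only [psiPlus, h, Nat.cast_ofNat]

theorem psiPlus_mul_conj (a b : Fin 2 → Fin 2) :
    psiPlus a * (starRingEnd ℂ) (psiPlus b)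
      = if bitWeight a = 1 ∧ bitWeight b = 1 then 1 / 2 else 0 := by
  rw [psiPlus_eq, psiPlus_eq]
  by_cases ha : bitWeight a = 1
  · by_cases hb : bitWeight b = 1
    · simpa only [ha, hb, and_self, if_true, Nat.cast_ofNat] using
        ofReal_one_div_sqrt_mul_conj 2
    · simp [hb]
  · simp [ha]

theorem WstateTriple_zero_mul_conj (N m k : ℕ) (a b : Fin 2 → Fin 2) (c : Fin k → Fin 2) :
    WstateTriple N m k a 0 c * (starRingEnd ℂ) (WstateTriple N m k b 0 c)
      = if bitWeight a + bitWeight c = 1 ∧ bitWeight b + bitWeight c = 1 then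
          1 / (N : ℂ) else 0 := by
  have h (x : Fin 2 → Fin 2) : WstateTriple N m k x 0 c
      = if bitWeight x + bitWeight c = 1 then ((1 / Real.sqrt N : ℝ) : ℂ) else 0 := by
    simp [WstateTriple, bitWeight]
  rw [h, h]
  by_cases ha : bitWeight a + bitWeight c = 1
  · by_cases hb : bitWeight b + bitWeight c = 1
    · simpa only [ha, hb, and_self, if_true] using ofReal_one_div_sqrt_mul_conj N
    · simp [hb]
  · simp [ha]

theorem sum_WstateTriple_zero_mul_conj (N m k : ℕ) (a b : Fin 2 → Fin 2) :
    ∑ c : Fin k → Fin 2,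
        WstateTriple N m k a 0 c * (starRingEnd ℂ) (WstateTriple N m k b 0 c)
      = (1 / (N : ℂ)) * (2 * (psiPlus a * (starRingEnd ℂ) (psiPlus b))
          + (k : ℂ) * (if a = 0 ∧ b = 0 then 1 else 0)) := by
  simp only [WstateTriple_zero_mul_conj, psiPlus_mul_conj, ← bitWeight_eq_zero_iff]
  rw [← Finset.sum_filter, Finset.sum_const, nsmul_eq_mul, mul_comm]
  congr 1
  by_cases h1 : bitWeight a = 1 ∧ bitWeight b = 1
  · simp [h1.1, h1.2, card_bitWeight_eq_zero]
  by_cases h0 : bitWeight a = 0 ∧ bitWeight b = 0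
  · simp [h0.1, h0.2, card_bitWeight_eq_one]
  have hempty : (Finset.univ.filter fun c : Fin k → Fin 2 =>
      bitWeight a + bitWeight c = 1 ∧ bitWeight b + bitWeight c = 1) = ∅ :=
    Finset.filter_eq_empty_iff.2 fun c _ => by omega
  simp [h1, h0, hempty]

theorem sum_psiPlus_mul_conj :
    ∑ a : Fin 2 → Fin 2, psiPlus a * (starRingEnd ℂ) (psiPlus a) = 1 := by
  simp only [psiPlus_mul_conj, and_self]
  rw [← Finset.sum_filter, Finset.sum_const, card_bitWeight_eq_one]
  norm_num

/-- Projecting the reduced state Tr_k |W_N⟩⟨W_N| onto the all-zero string of the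
middle N−k−2 coordinates and tracing these out yields the two-qubit matrix
(1/N)·(2|ψ⁺⟩⟨ψ⁺| + k|00⟩⟨00|); its trace is (2+k)/N, and the normalized
conditional state is ω̃_k = (2/(2+k))|ψ⁺⟩⟨ψ⁺| + (k/(2+k))|00⟩⟨00|. -/
theorem W_loss_projected_state (N k : ℕ) (hN : 3 ≤ N) (hk : 1 ≤ k) (hkN : k ≤ N - 2) :
    ((fun a b : Fin 2 → Fin 2 =>
        ∑ c : Fin k → Fin 2,
          WstateTriple N (N - k - 2) k a 0 c *
            (starRingEnd ℂ) (WstateTriple N (N - k - 2) k b 0 c))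
      = fun a b : Fin 2 → Fin 2 =>
          (1 / (N : ℂ)) * (2 * (psiPlus a * (starRingEnd ℂ) (psiPlus b))
            + (k : ℂ) * (if a = 0 ∧ b = 0 then 1 else 0)))
    ∧ (∑ a : Fin 2 → Fin 2, ∑ c : Fin k → Fin 2,
          WstateTriple N (N - k - 2) k a 0 c *
            (starRingEnd ℂ) (WstateTriple N (N - k - 2) k a 0 c))
        = ((2 + k : ℕ) : ℂ) / N
    ∧ ((fun a b : Fin 2 → Fin 2 =>
        ((N : ℂ) / ((2 + k : ℕ) : ℂ)) *
          ∑ c : Fin k → Fin 2,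
            WstateTriple N (N - k - 2) k a 0 c *
              (starRingEnd ℂ) (WstateTriple N (N - k - 2) k b 0 c))
      = fun a b : Fin 2 → Fin 2 =>
          (2 / ((2 + k : ℕ) : ℂ)) * (psiPlus a * (starRingEnd ℂ) (psiPlus b))
            + ((k : ℂ) / ((2 + k : ℕ) : ℂ)) * (if a = 0 ∧ b = 0 then 1 else 0)) := by
  refine ⟨?_, ?_, ?_⟩
  · funext a b
    exact sum_WstateTriple_zero_mul_conj N _ k a b
  · simp only [sum_WstateTriple_zero_mul_conj]
    rw [← Finset.mul_sum, Finset.sum_add_distrib, ← Finset.mul_sum, ← Finset.mul_sum,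
      sum_psiPlus_mul_conj]
    simp only [and_self, Finset.sum_ite_eq', Finset.mem_univ, if_true]
    push_cast
    ring
  · funext a b
    have hN0 : (N : ℂ) ≠ 0 := by
      rw [Nat.cast_ne_zero]
      omega
    have hk0 : ((2 + k : ℕ) : ℂ) ≠ 0 := by
      rw [Nat.cast_ne_zero]
      omega
    rw [sum_WstateTriple_zero_mul_conj]
    field_simp
end

section
/- For every natural number k, the two-qubit state ω̃_k = (2/(2+k))|ψ⁺⟩⟨ψ⁺| + (k/(2+k))|00⟩⟨00| has fidelity ⟨ψ⁺, ω̃_k ψ⁺⟩ = 2/(2+k) with the maximally entangled state ψ⁺, and this fidelity is strictly greater than 1/2 if and only if k < 2. In particular, the anonymous entanglement produced from the W state after exactly one particle loss (k = 1) has fidelity 2/3 > 1/2, so the protocol tolerates one non-responsive node. -/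
open Finset

/-- The two-qubit state ω̃_k = (2/(2+k))|ψ⁺⟩⟨ψ⁺| + (k/(2+k))|00⟩⟨00|. -/
noncomputable def omegaTilde (k : ℕ) (a b : Fin 2 → Fin 2) : ℂ :=
  (2 / ((2 : ℂ) + k)) * (psiPlus a * (starRingEnd ℂ) (psiPlus b))
    + ((k : ℂ) / ((2 : ℂ) + k)) * (if a = 0 ∧ b = 0 then 1 else 0)

theorem psiPlus_zero : psiPlus 0 = 0 := by
  simp [psiPlus]

/-- The vector ψ⁺ has unit norm. -/
theorem sum_conj_psiPlus_mul_psiPlus :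
    ∑ x : Fin 2 → Fin 2, (starRingEnd ℂ) (psiPlus x) * psiPlus x = 1 := by
  have h : ((Real.sqrt 2 : ℝ) : ℂ)⁻¹ * ((Real.sqrt 2 : ℝ) : ℂ)⁻¹ = 1 / 2 := by
    rw [← mul_inv, ← Complex.ofReal_mul, Real.mul_self_sqrt (by norm_num)]
    norm_num
  rw [← (finTwoArrowEquiv (Fin 2)).symm.sum_comp, Fintype.sum_prod_type]
  simp only [Fin.sum_univ_two]
  simp [psiPlus, finTwoArrowEquiv, h]
  norm_num

theorem conj_psiPlus_mul_omegaTilde_mul_psiPlus (k : ℕ) (x y : Fin 2 → Fin 2) :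
    (starRingEnd ℂ) (psiPlus x) * omegaTilde k x y * psiPlus y
      = 2 / ((2 : ℂ) + k) * (((starRingEnd ℂ) (psiPlus x) * psiPlus x)
          * ((starRingEnd ℂ) (psiPlus y) * psiPlus y)) := by
  unfold omegaTilde
  split_ifs with h
  · simp [h.1, psiPlus_zero]
  · ring

/-- The fidelity ⟨ψ⁺, ω̃_k ψ⁺⟩ equals 2/(2+k), and it exceeds 1/2 iff k < 2.
In particular (k = 1) the protocol tolerates one non-responsive node. -/
theorem omegaTilde_fidelity (k : ℕ) :
    ((∑ x : Fin 2 → Fin 2, ∑ y : Fin 2 → Fin 2,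
        (starRingEnd ℂ) (psiPlus x) * omegaTilde k x y * psiPlus y)
      = 2 / ((2 : ℂ) + k))
    ∧ ((1 / 2 : ℝ) < 2 / ((2 : ℝ) + k) ↔ k < 2) := by
  constructor
  · simp only [conj_psiPlus_mul_omegaTilde_mul_psiPlus, ← Finset.mul_sum,
      sum_conj_psiPlus_mul_psiPlus, mul_one]
  · rw [div_lt_div_iff₀ (by norm_num) (by positivity), ← Nat.cast_lt (α := ℝ)]
    push_cast
    constructor <;> intro h <;> linarith
end

section
/- For every N ≥ 2 and every q ∈ [0,1], the fidelity of the anonymous entanglement produced by the W-state protocol under N-fold dephasing noise equals 1 − 2q(1−q), independently of N. Precisely, with ρ = 𝒫_q^{⊗N}(|W_N⟩⟨W_N|) and v = ψ⁺ ⊗ |0…0⟩, one has ⟨v, ρ v⟩ / Tr[ρ·(1⊗P₀)] = 1 − 2q(1−q). -/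
open Finset

/-- The N-qubit vector ψ⁺ ⊗ |0…0⟩: ψ⁺ on the first two qubits and |0⟩ on each
of the last N−2 qubits. -/
noncomputable def psiPlusExt (N : ℕ) (hN : 2 ≤ N) (x : Fin N → Fin 2) : ℂ :=
  if ∀ i : Fin N, 2 ≤ (i : ℕ) → x i = 0 then
    psiPlus (fun j : Fin 2 => x (Fin.castLE hN j)) else 0

/-- The N-fold dephasing channel with parameter q acting entrywise:
(𝒫_q^{⊗N} ρ)_{x,y} = (2q−1)^{d(x,y)} ρ_{x,y}, with d the Hamming distance. -/
noncomputable def dephase (N : ℕ) (q : ℝ)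
    (ρ : (Fin N → Fin 2) → (Fin N → Fin 2) → ℂ) (x y : Fin N → Fin 2) : ℂ :=
  (((2 * q - 1) ^ hammingDist x y : ℝ) : ℂ) * ρ x y

/-- A bit string has weight one if and only if it is a standard basis string. -/
theorem sum_val_eq_one_iff {N : ℕ} (x : Fin N → Fin 2) :
    (∑ i, (x i : ℕ)) = 1 ↔ ∃ i, x = Pi.single i 1 := by
  constructor
  · intro h
    obtain ⟨i, hi⟩ : ∃ i, x i ≠ 0 := by
      by_contra! hx
      simp [hx] at h
    have hsplit := Finset.add_sum_erase univ (fun j => (x j : ℕ)) (mem_univ i)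
    have hxi : (x i : ℕ) ≠ 0 := fun h0 => hi (Fin.ext h0)
    have hrest : ∑ j ∈ univ.erase i, (x j : ℕ) = 0 := by
      omega
    refine ⟨i, funext fun j => ?_⟩
    by_cases hji : j = i
    · subst hji
      rw [Pi.single_eq_same]
      omega
    · rw [Pi.single_eq_of_ne hji]
      exact Fin.ext (Finset.sum_eq_zero_iff.mp hrest j (by simp [hji]))
  · rintro ⟨i, rfl⟩
    rw [Finset.sum_eq_single i] <;> simp +contextual

theorem Wstate_single {N : ℕ} (i : Fin N) :
    Wstate N (Pi.single i 1) = ((1 / Real.sqrt N : ℝ) : ℂ) :=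
  if_pos ((sum_val_eq_one_iff _).mpr ⟨i, rfl⟩)

theorem hammingDist_single_single {N : ℕ} {i j : Fin N} (hij : i ≠ j) :
    hammingDist (Pi.single i 1 : Fin N → Fin 2) (Pi.single j 1) = 2 := by
  have h : (univ.filter fun k => (Pi.single i 1 : Fin N → Fin 2) k ≠
      (Pi.single j 1 : Fin N → Fin 2) k) = {i, j} := by
    ext k
    by_cases hi : k = i
    · subst hi
      simp [hij]
    · by_cases hj : k = j
      · subst hj
        simp [hi]
      · simp [hi, hj]
  rw [hammingDist, h, card_pair hij]

theorem psiPlusExt_eq {N : ℕ} (hN : 2 ≤ N) (x : Fin N → Fin 2) :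
    psiPlusExt N hN x =
      (if x = Pi.single (Fin.castLE hN 0) 1 then ((1 / Real.sqrt 2 : ℝ) : ℂ) else 0) +
      (if x = Pi.single (Fin.castLE hN 1) 1 then ((1 / Real.sqrt 2 : ℝ) : ℂ) else 0) := by
  have hne : Fin.castLE hN 0 ≠ Fin.castLE hN 1 := by simp [Fin.ext_iff]
  by_cases h0 : x = Pi.single (Fin.castLE hN 0) 1
  · have h1 : x ≠ Pi.single (Fin.castLE hN 1) 1 := by
      rintro rfl
      simpa [hne] using congrFun h0 (Fin.castLE hN 0)
    have hz : ∀ i : Fin N, 2 ≤ (i : ℕ) → x i = 0 := fun i hi => by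
      rw [h0, Pi.single_eq_of_ne]
      rintro rfl
      simp at hi
    rw [psiPlusExt, if_pos hz, if_pos h0, if_neg h1, psiPlus, if_pos, add_zero]
    right
    simp [h0, hne.symm]
  · by_cases h1 : x = Pi.single (Fin.castLE hN 1) 1
    · have hz : ∀ i : Fin N, 2 ≤ (i : ℕ) → x i = 0 := fun i hi => by
        rw [h1, Pi.single_eq_of_ne]
        rintro rfl
        simp at hi
      rw [psiPlusExt, if_pos hz, if_neg h0, if_pos h1, psiPlus, if_pos, zero_add]
      left
      simp [h1, hne]
    · rw [if_neg h0, if_neg h1, add_zero, psiPlusExt]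
      split_ifs with hz
      · rw [psiPlus, if_neg]
        have key : ∀ a b : Fin 2, x (Fin.castLE hN a) = 1 → x (Fin.castLE hN b) = 0 → a ≠ b →
            x = Pi.single (Fin.castLE hN a) 1 := by
          intro a b ha hb hab
          funext k
          by_cases hk : 2 ≤ (k : ℕ)
          · rw [hz k hk, Pi.single_eq_of_ne]
            rintro rfl
            have := a.isLt
            simp at hk
            omega
          · obtain ⟨c, rfl⟩ : ∃ c : Fin 2, k = Fin.castLE hN c := ⟨⟨k, by omega⟩, rfl⟩
            by_cases hca : c = a
            · subst hca
              simp [ha]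
            · have hcb : c = b := by omega
              subst hcb
              rw [hb, Pi.single_eq_of_ne]
              simpa using hca
        rintro (⟨ha, hb⟩ | ⟨ha, hb⟩)
        · exact h1 (key 1 0 hb ha (by decide))
        · exact h0 (key 0 1 ha hb (by decide))
      · rfl

theorem sum_dephase_Wstate_diag {N : ℕ} (hN : 2 ≤ N) (q : ℝ) :
    (∑ x ∈ Finset.univ.filter
        (fun x : Fin N → Fin 2 => ∀ i : Fin N, 2 ≤ (i : ℕ) → x i = 0),
      dephase N q (fun x y => Wstate N x * (starRingEnd ℂ) (Wstate N y)) x x) = 2 / N := by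
  have hne : (Pi.single (Fin.castLE hN 0) 1 : Fin N → Fin 2) ≠
      Pi.single (Fin.castLE hN 1) 1 := fun h => by
    have := congrFun h (Fin.castLE hN 0)
    simp [Fin.ext_iff] at this
  have hsq : (((Real.sqrt N : ℝ) : ℂ)) * ((Real.sqrt N : ℝ) : ℂ) = N := by
    rw [← Complex.ofReal_mul, Real.mul_self_sqrt (Nat.cast_nonneg N), Complex.ofReal_natCast]
  rw [← Finset.sum_subset (s₁ := {Pi.single (Fin.castLE hN 0) 1, Pi.single (Fin.castLE hN 1) 1}),
    Finset.sum_pair hne]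
  · simp only [dephase, Wstate_single, hammingDist_self, pow_zero, Complex.conj_ofReal]
    push_cast
    rw [one_div_mul_one_div, hsq]
    ring
  · intro x hx
    simp only [mem_insert, mem_singleton] at hx
    simp only [mem_filter, mem_univ, true_and]
    intro i hi
    rcases hx with rfl | rfl <;>
    · rw [Pi.single_eq_of_ne]
      rintro rfl
      simp at hi
  · intro x hx hx'
    simp only [mem_filter, mem_univ, true_and] at hx
    have hW : Wstate N x = 0 := by
      refine if_neg fun h => hx' ?_
      obtain ⟨i, rfl⟩ := (sum_val_eq_one_iff x).mp h
      have hi : (i : ℕ) < 2 := by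
        by_contra! hi
        simpa using hx i hi
      obtain ⟨c, rfl⟩ : ∃ c : Fin 2, i = Fin.castLE hN c := ⟨⟨i, hi⟩, rfl⟩
      fin_cases c <;> simp
    simp [dephase, hW]

/-- Under N-fold dephasing noise, the fidelity of the anonymous entanglement
produced by the W-state protocol equals 1 − 2q(1−q), independently of N:
⟨v, ρ v⟩ / Tr[ρ·(1⊗P₀)] = 1 − 2q(1−q), where ρ = 𝒫_q^{⊗N}(|W_N⟩⟨W_N|) and
v = ψ⁺ ⊗ |0…0⟩. -/
theorem W_dephasing_fidelity (N : ℕ) (hN : 2 ≤ N) (q : ℝ) (hq : q ∈ Set.Icc (0 : ℝ) 1) :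
    (∑ x : Fin N → Fin 2, ∑ y : Fin N → Fin 2,
        (starRingEnd ℂ) (psiPlusExt N hN x) *
          dephase N q (fun x y => Wstate N x * (starRingEnd ℂ) (Wstate N y)) x y *
          psiPlusExt N hN y)
      /
    (∑ x ∈ Finset.univ.filter
        (fun x : Fin N → Fin 2 => ∀ i : Fin N, 2 ≤ (i : ℕ) → x i = 0),
      dephase N q (fun x y => Wstate N x * (starRingEnd ℂ) (Wstate N y)) x x)
    = ((1 - 2 * q * (1 - q) : ℝ) : ℂ) := by
  have hne : Fin.castLE hN 0 ≠ Fin.castLE hN 1 := by simp [Fin.ext_iff]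
  have hN0 : (N : ℂ) ≠ 0 := by
    rw [Nat.cast_ne_zero]
    omega
  have hsq : (((Real.sqrt N : ℝ) : ℂ)) * ((Real.sqrt N : ℝ) : ℂ) = N := by
    rw [← Complex.ofReal_mul, Real.mul_self_sqrt (Nat.cast_nonneg N), Complex.ofReal_natCast]
  have hsq2 : ((Real.sqrt 2 : ℝ) : ℂ) * ((Real.sqrt 2 : ℝ) : ℂ) = 2 := by
    rw [← Complex.ofReal_mul, Real.mul_self_sqrt zero_le_two, Complex.ofReal_ofNat]
  have hmul : ∀ d : ℂ, 1 / ((Real.sqrt 2 : ℝ) : ℂ) *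
      (d * (1 / ((Real.sqrt N : ℝ) : ℂ) * (1 / ((Real.sqrt N : ℝ) : ℂ)))) *
      (1 / ((Real.sqrt 2 : ℝ) : ℂ)) = d / (2 * N) := fun d => by
    rw [← hsq, ← hsq2]
    simp only [div_eq_mul_inv, mul_inv]
    ring
  rw [sum_dephase_Wstate_diag hN]
  simp only [psiPlusExt_eq, map_add, apply_ite (starRingEnd ℂ), map_zero, Complex.conj_ofReal,
    add_mul, mul_add, Finset.sum_add_distrib, ite_mul, mul_ite, zero_mul, mul_zero,
    Finset.sum_ite_eq', mem_univ, if_true]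
  simp only [dephase, Wstate_single, hammingDist_self, hammingDist_single_single hne,
    hammingDist_single_single hne.symm, Complex.conj_ofReal]
  push_cast
  simp only [hmul]
  field_simp
  ring
end

section
/- For every N ≥ 2 and every q ∈ [0,1], the fidelity of the anonymous entanglement produced by the GHZ-state protocol under N-fold dephasing noise equals (1 + (2q−1)^N)/2. Precisely, with ρ = 𝒫_q^{⊗N}(|G_N⟩⟨G_N|) and v = φ⁺ ⊗ |+…+⟩, one has ⟨v, ρ v⟩ / Tr[ρ·(1⊗P₊)] = (1 + (2q−1)^N)/2. -/
open Finset

/-- The N-qubit GHZ state: amplitude 1/√2 on the two constant strings and 0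
elsewhere. -/
noncomputable def GHZ (N : ℕ) (x : Fin N → Fin 2) : ℂ :=
  if ∀ i j : Fin N, x i = x j then ((1 / Real.sqrt 2 : ℝ) : ℂ) else 0

/-- The two-qubit maximally entangled state φ⁺: amplitude 1/√2 on the strings
00 and 11 and 0 elsewhere. -/
noncomputable def phiPlus (a : Fin 2 → Fin 2) : ℂ :=
  if (a 0 = 0 ∧ a 1 = 0) ∨ (a 0 = 1 ∧ a 1 = 1) then ((1 / Real.sqrt 2 : ℝ) : ℂ) else 0

/-- The N-qubit vector φ⁺ ⊗ |+…+⟩: amplitude on x is (φ⁺ on the first two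
coordinates of x) · 2^{−(N−2)/2}. -/
noncomputable def phiPlusExt (N : ℕ) (hN : 2 ≤ N) (x : Fin N → Fin 2) : ℂ :=
  phiPlus (fun j : Fin 2 => x (Fin.castLE hN j)) *
    ((1 / Real.sqrt (2 ^ (N - 2)) : ℝ) : ℂ)

/-- The N-qubit string assembled from a two-qubit string `a` (first two
coordinates) and an (N−2)-qubit string `z` (remaining coordinates). -/
def glue (N : ℕ) (a : Fin 2 → Fin 2) (z : Fin (N - 2) → Fin 2) (j : Fin N) : Fin 2 :=
  if h : (j : ℕ) < 2 then a ⟨(j : ℕ), h⟩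
  else z ⟨(j : ℕ) - 2, by have := j.isLt; omega⟩

theorem GHZ_eq_ite (N : ℕ) (i₀ : Fin N) (x : Fin N → Fin 2) :
    GHZ N x = if x = (fun _ => x i₀) then ((1 / Real.sqrt 2 : ℝ) : ℂ) else 0 := by
  unfold GHZ
  congr 1
  exact propext ⟨fun h => funext fun i => h i i₀,
    fun h i j => (congrFun h i).trans (congrFun h j).symm⟩

theorem conj_GHZ (N : ℕ) (x : Fin N → Fin 2) : (starRingEnd ℂ) (GHZ N x) = GHZ N x := by
  unfold GHZ
  split_ifs <;> simp only [Complex.conj_ofReal, map_zero]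

theorem GHZ_const (N : ℕ) (b : Fin 2) : GHZ N (fun _ => b) = ((1 / Real.sqrt 2 : ℝ) : ℂ) := by
  simp [GHZ]

theorem sum_GHZ_mul (N : ℕ) (i₀ : Fin N) (f : (Fin N → Fin 2) → ℂ) :
    ∑ x, GHZ N x * f x = ((1 / Real.sqrt 2 : ℝ) : ℂ) * ∑ b : Fin 2, f (fun _ => b) := by
  have hinj : Function.Injective (fun (b : Fin 2) (_ : Fin N) => b) :=
    fun _ _ h => congrFun h i₀
  rw [mul_sum]
  refine (Fintype.sum_of_injective _ hinj _ _ (fun x hx => ?_) fun b => ?_).symm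
  · rw [GHZ_eq_ite N i₀, if_neg fun h => hx ⟨x i₀, h.symm⟩, zero_mul]
  · rw [GHZ_const]

theorem glue_const (N : ℕ) (b : Fin 2) : glue N (fun _ => b) (fun _ => b) = fun _ => b := by
  funext j
  simp [glue]

theorem eq_const_of_glue_eq_const {N : ℕ} (hN : 2 ≤ N) {a : Fin 2 → Fin 2}
    {z : Fin (N - 2) → Fin 2} {b : Fin 2} (h : glue N a z = fun _ => b) :
    a = (fun _ => b) ∧ z = fun _ => b := by
  refine ⟨funext fun i => ?_, funext fun k => ?_⟩
  · simpa [glue, Nat.lt_succ_iff.mp i.isLt] using congrFun h (Fin.castLE hN i)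
  · simpa [glue] using congrFun h ⟨k + 2, by omega⟩

theorem GHZ_glue_of_ne {N : ℕ} (hN : 2 ≤ N) {a : Fin 2 → Fin 2} {z : Fin (N - 2) → Fin 2}
    (h : ¬ (a = (fun _ => a 0) ∧ z = fun _ => a 0)) : GHZ N (glue N a z) = 0 := by
  rw [GHZ_eq_ite N ⟨0, by omega⟩, if_neg]
  intro hc
  refine h (eq_const_of_glue_eq_const hN (hc.trans ?_))
  simp [glue]

theorem sum_GHZ_glue_mul {N : ℕ} (hN : 2 ≤ N) (b : Fin 2) (f : (Fin (N - 2) → Fin 2) → ℂ) :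
    ∑ z, GHZ N (glue N (fun _ => b) z) * f z
      = ((1 / Real.sqrt 2 : ℝ) : ℂ) * f (fun _ => b) := by
  rw [Fintype.sum_eq_single (fun _ => b), glue_const, GHZ_const]
  intro z hz
  rw [GHZ_glue_of_ne hN (fun h => hz h.2), zero_mul]

theorem ofReal_one_div_sqrt_mul_self (a : ℝ) (ha : 0 ≤ a) :
    ((1 / Real.sqrt a : ℝ) : ℂ) * ((1 / Real.sqrt a : ℝ) : ℂ) = 1 / (a : ℂ) := by
  rw [← Complex.ofReal_mul, div_mul_div_comm, Real.mul_self_sqrt ha]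
  simp

theorem hammingDist_const (N : ℕ) (b c : Fin 2) :
    hammingDist (fun _ : Fin N => b) (fun _ => c) = if b = c then 0 else N := by
  split_ifs with h
  · simp [h]
  · simp [hammingDist, h]

theorem phiPlusExt_const (N : ℕ) (hN : 2 ≤ N) (b : Fin 2) :
    phiPlusExt N hN (fun _ => b)
      = ((1 / Real.sqrt 2 : ℝ) : ℂ) * ((1 / Real.sqrt (2 ^ (N - 2)) : ℝ) : ℂ) := by
  fin_cases b <;> simp [phiPlusExt, phiPlus]

/-- The overlap of the dephased GHZ state with `φ⁺ ⊗ |+…+⟩`. -/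
theorem GHZ_dephasing_overlap (N : ℕ) (hN : 2 ≤ N) (q : ℝ) :
    (∑ x : Fin N → Fin 2, ∑ y : Fin N → Fin 2,
        (starRingEnd ℂ) (phiPlusExt N hN x) *
          dephase N q (fun x y => GHZ N x * (starRingEnd ℂ) (GHZ N y)) x y *
          phiPlusExt N hN y)
      = (((1 + (2 * q - 1) ^ N) / 2 : ℝ) : ℂ) * (1 / (2 : ℂ) ^ (N - 2)) := by
  have i₀ : Fin N := ⟨0, by omega⟩
  have h2 := ofReal_one_div_sqrt_mul_self 2 zero_le_two
  have hk := ofReal_one_div_sqrt_mul_self (2 ^ (N - 2)) (by positivity)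
  calc
    _ = ∑ x, GHZ N x * ∑ y, GHZ N y * ((starRingEnd ℂ) (phiPlusExt N hN x) *
          (((2 * q - 1) ^ hammingDist x y : ℝ) : ℂ) * phiPlusExt N hN y) := by
      simp only [mul_sum, dephase, conj_GHZ]
      exact sum_congr rfl fun x _ => sum_congr rfl fun y _ => by ring
    _ = _ := by
      simp only [sum_GHZ_mul N i₀, phiPlusExt_const, hammingDist_const, map_mul,
        Complex.conj_ofReal, Fin.sum_univ_two, if_true, zero_ne_one, one_ne_zero, if_false]
      generalize ((1 / Real.sqrt 2 : ℝ) : ℂ) = s at *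
      generalize ((1 / Real.sqrt (2 ^ (N - 2)) : ℝ) : ℂ) = t at *
      push_cast at *
      rw [← hk]
      linear_combination (2 * (1 + (2 * (q : ℂ) - 1) ^ N) * t * t) * (s * s + 1 / 2) * h2

/-- The probability that the last `N - 2` qubits of the dephased GHZ state are found in
`|+…+⟩`. -/
theorem GHZ_dephasing_trace (N : ℕ) (hN : 2 ≤ N) (q : ℝ) :
    (∑ a : Fin 2 → Fin 2, ∑ z : Fin (N - 2) → Fin 2, ∑ w : Fin (N - 2) → Fin 2,
        dephase N q (fun x y => GHZ N x * (starRingEnd ℂ) (GHZ N y))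
            (glue N a z) (glue N a w) *
          (1 / (2 : ℂ) ^ (N - 2)))
      = 1 / (2 : ℂ) ^ (N - 2) := by
  have h2 := ofReal_one_div_sqrt_mul_self 2 zero_le_two
  have hinj : Function.Injective (fun (b : Fin 2) (_ : Fin 2) => b) :=
    fun _ _ h => congrFun h 0
  calc
    _ = ∑ a, ∑ z, GHZ N (glue N a z) * ∑ w, GHZ N (glue N a w) *
          ((((2 * q - 1) ^ hammingDist (glue N a z) (glue N a w) : ℝ) : ℂ) *
            (1 / (2 : ℂ) ^ (N - 2))) := by
      simp only [mul_sum, dephase, conj_GHZ]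
      exact sum_congr rfl fun a _ => sum_congr rfl fun z _ => sum_congr rfl fun w _ => by ring
    _ = ∑ b : Fin 2, ∑ z, GHZ N (glue N (fun _ => b) z) * ∑ w, GHZ N (glue N (fun _ => b) w) *
          ((((2 * q - 1) ^ hammingDist (glue N (fun _ => b) z) (glue N (fun _ => b) w) : ℝ) : ℂ) *
            (1 / (2 : ℂ) ^ (N - 2))) := by
      refine (Fintype.sum_of_injective _ hinj _ _ (fun a ha => ?_) fun _ => rfl).symm
      refine sum_eq_zero fun z _ => ?_
      rw [GHZ_glue_of_ne hN (fun h => ha ⟨a 0, h.1.symm⟩), zero_mul]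
    _ = _ := by
      simp only [sum_GHZ_glue_mul hN, hammingDist_self, pow_zero, Complex.ofReal_one, one_mul,
        Fin.sum_univ_two]
      push_cast at *
      linear_combination (2 / 2 ^ (N - 2)) * h2

/-- Under N-fold dephasing noise, the fidelity of the anonymous entanglement
produced by the GHZ-state protocol equals (1 + (2q−1)^N)/2:
⟨v, ρ v⟩ / Tr[ρ·(1⊗P₊)] = (1 + (2q−1)^N)/2, where ρ = 𝒫_q^{⊗N}(|G_N⟩⟨G_N|)
and v = φ⁺ ⊗ |+…+⟩. -/
theorem GHZ_dephasing_fidelity (N : ℕ) (hN : 2 ≤ N) (q : ℝ) (hq : q ∈ Set.Icc (0 : ℝ) 1) :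
    (∑ x : Fin N → Fin 2, ∑ y : Fin N → Fin 2,
        (starRingEnd ℂ) (phiPlusExt N hN x) *
          dephase N q (fun x y => GHZ N x * (starRingEnd ℂ) (GHZ N y)) x y *
          phiPlusExt N hN y)
      /
    (∑ a : Fin 2 → Fin 2, ∑ z : Fin (N - 2) → Fin 2, ∑ w : Fin (N - 2) → Fin 2,
        dephase N q (fun x y => GHZ N x * (starRingEnd ℂ) (GHZ N y))
            (glue N a z) (glue N a w) *
          (1 / (2 : ℂ) ^ (N - 2)))
    = (((1 + (2 * q - 1) ^ N) / 2 : ℝ) : ℂ) := by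
  rw [GHZ_dephasing_overlap, GHZ_dephasing_trace N hN, mul_div_assoc, div_self (by simp),
    mul_one]
end

section
/- For every natural number N ≥ 2 and every real q ∈ [0,1], the inequality 1 − 2q(1−q) ≥ (1 + (2q−1)^N)/2 holds. (This expresses that under dephasing network noise the fidelity of anonymous entanglement obtained from the W state is at least that obtained from the GHZ state, for all N ≥ 2 and all noise parameters q.) -/
/-- Under dephasing network noise the fidelity of anonymous entanglement
obtained from the W state, 1 − 2q(1−q), is at least that obtained from the
GHZ state, (1 + (2q−1)^N)/2, for all N ≥ 2 and all q ∈ [0,1]. -/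
theorem W_dephasing_fidelity_ge_GHZ (N : ℕ) (hN : 2 ≤ N)
    (q : ℝ) (hq : q ∈ Set.Icc (0 : ℝ) 1) :
    (1 + (2 * q - 1) ^ N) / 2 ≤ 1 - 2 * q * (1 - q) := by
  have habs : |2 * q - 1| ≤ 1 := abs_le.mpr ⟨by linarith [hq.1], by linarith [hq.2]⟩
  have hpow : (2 * q - 1) ^ N ≤ (2 * q - 1) ^ 2 :=
    calc (2 * q - 1) ^ N ≤ |2 * q - 1| ^ N := (le_abs_self _).trans_eq (abs_pow _ _)
      _ ≤ |2 * q - 1| ^ 2 := pow_le_pow_of_le_one (abs_nonneg _) habs hN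
      _ = (2 * q - 1) ^ 2 := sq_abs _
  linarith
end

section
/- For every N ≥ 2 and every q ∈ [0,1], the fidelity of the anonymous entanglement produced by the GHZ-state protocol under N-fold depolarizing noise equals (2q^N + q² + 1)/4. Precisely, with ρ = 𝒟_q^{⊗N}(|G_N⟩⟨G_N|) and v = φ⁺ ⊗ |+…+⟩, one has ⟨v, ρ v⟩ / Tr[ρ·(1⊗P₊)] = (2q^N + q² + 1)/4. -/
open Finset

/-- The N-fold depolarizing channel with parameter q:
𝒟_q^{⊗N}(ρ) = Σ_{S ⊆ Fin N} q^{N−|S|}(1−q)^{|S|} Φ_S(ρ), where Φ_S replaces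
the qubits in S by the maximally mixed state. -/
noncomputable def depolarize (N : ℕ) (q : ℝ)
    (ρ : (Fin N → Fin 2) → (Fin N → Fin 2) → ℂ) (x y : Fin N → Fin 2) : ℂ :=
  ∑ S : Finset (Fin N),
    ((q ^ (N - S.card) * (1 - q) ^ S.card : ℝ) : ℂ) *
      (if ∀ i ∈ S, x i = y i then
        ((2 : ℂ) ^ S.card)⁻¹ *
          ∑ z : {i // i ∈ S} → Fin 2,
            ρ (fun j => if h : j ∈ S then z ⟨j, h⟩ else x j)
              (fun j => if h : j ∈ S then z ⟨j, h⟩ else y j)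
      else 0)

/-- Linearity of the depolarizing channel. -/
theorem depolarize_mul_sum {ι : Type*} [Fintype ι] (N : ℕ) (q : ℝ) (c : ℂ)
    (ρ : ι → (Fin N → Fin 2) → (Fin N → Fin 2) → ℂ) (x y : Fin N → Fin 2) :
    depolarize N q (fun x y => c * ∑ k, ρ k x y) x y = c * ∑ k, depolarize N q (ρ k) x y := by
  unfold depolarize
  rw [Finset.sum_comm, Finset.mul_sum]
  refine Finset.sum_congr rfl fun S _ => ?_
  split_ifs
  · simp only [Finset.mul_sum, mul_left_comm c]
    rw [Finset.sum_comm]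
  · simp

/-- The depolarizing channel acts factorwise on product matrices. -/
theorem depolarize_prod (N : ℕ) (q : ℝ) (f : Fin 2 → Fin 2 → ℂ) (x y : Fin N → Fin 2) :
    depolarize N q (fun x y => ∏ i, f (x i) (y i)) x y =
      ∏ i, ((if x i = y i then (1 - q : ℂ) / 2 * ∑ c, f c c else 0) + q * f (x i) (y i)) := by
  unfold depolarize
  rw [Finset.prod_add, Finset.powerset_univ]
  refine Finset.sum_congr rfl fun S _ => ?_
  have hsum : ∑ z : {i // i ∈ S} → Fin 2, ∏ j,
      f (if h : j ∈ S then z ⟨j, h⟩ else x j) (if h : j ∈ S then z ⟨j, h⟩ else y j) =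
        (∑ c, f c c) ^ S.card * ∏ j ∈ univ \ S, f (x j) (y j) := by
    have h (z : {i // i ∈ S} → Fin 2) : ∏ j,
        f (if h : j ∈ S then z ⟨j, h⟩ else x j) (if h : j ∈ S then z ⟨j, h⟩ else y j) =
          (∏ j, f (z j) (z j)) * ∏ j ∈ univ \ S, f (x j) (y j) := by
      rw [← Finset.prod_sdiff (Finset.subset_univ S), mul_comm]
      congr 1
      · rw [← Finset.prod_coe_sort]
        exact Finset.prod_congr rfl fun j _ => by simp
      · refine Finset.prod_congr rfl fun j hj => ?_
        have : j ∉ S := (Finset.mem_sdiff.1 hj).2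
        simp [this]
    simp_rw [h]
    rw [← Finset.sum_mul, ← Fintype.prod_sum (fun (_ : {i // i ∈ S}) c => f c c)]
    simp
  rw [hsum, Finset.prod_mul_distrib, Finset.prod_const,
    Finset.card_sdiff_of_subset (Finset.subset_univ S), Finset.card_univ, Fintype.card_fin]
  split_ifs with hxy
  · rw [Finset.prod_congr rfl fun i hi => if_pos (hxy i hi), Finset.prod_const]
    push_cast
    rw [mul_pow, div_pow]
    ring
  · push Not at hxy
    obtain ⟨i, hi, hne⟩ := hxy
    rw [Finset.prod_eq_zero hi (if_neg hne)]
    simp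

theorem GHZ_eq_sum (N : ℕ) (hN : 2 ≤ N) (x : Fin N → Fin 2) :
    GHZ N x = ((1 / Real.sqrt 2 : ℝ) : ℂ) * ∑ s : Fin 2, ∏ i, if x i = s then 1 else 0 := by
  have i₀ : Fin N := ⟨0, by omega⟩
  unfold GHZ
  simp only [Finset.prod_boole, Finset.mem_univ, true_implies]
  split_ifs with h
  · rw [Finset.sum_eq_single (x i₀)]
    · simp [fun i => h i i₀]
    · intro s _ hs
      exact if_neg fun h' => hs (h' i₀).symm
    · simp
  · rw [Finset.sum_eq_zero, mul_zero]
    intro s _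
    exact if_neg fun h' => h fun i j => (h' i).trans (h' j).symm

theorem inv_sqrt_two_mul_self :
    ((1 / Real.sqrt 2 : ℝ) : ℂ) * ((1 / Real.sqrt 2 : ℝ) : ℂ) = 1 / 2 := by
  rw [← Complex.ofReal_mul, div_mul_div_comm, Real.mul_self_sqrt (by norm_num)]
  norm_num

theorem GHZ_mul_conj (N : ℕ) (hN : 2 ≤ N) (x y : Fin N → Fin 2) :
    GHZ N x * (starRingEnd ℂ) (GHZ N y) = 1 / 2 * ∑ p : Fin 2 × Fin 2,
      ∏ i, ((if x i = p.1 then 1 else 0) * if y i = p.2 then 1 else 0) := by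
  rw [GHZ_eq_sum N hN, GHZ_eq_sum N hN, map_mul, Complex.conj_ofReal, mul_mul_mul_comm,
    inv_sqrt_two_mul_self]
  congr 1
  simp only [map_sum, map_prod, apply_ite (starRingEnd ℂ), map_one, map_zero,
    Finset.prod_mul_distrib, Finset.sum_mul_sum, Fintype.sum_prod_type]

/-- The image of the matrix unit `|s⟩⟨t|` under the single-qubit depolarizing channel. -/
noncomputable def depolarizedUnit (q : ℝ) (s t x y : Fin 2) : ℂ :=
  (if x = y then (1 - q : ℂ) / 2 * (if s = t then 1 else 0) else 0) +
    q * ((if x = s then 1 else 0) * if y = t then 1 else 0)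

theorem depolarize_GHZ (N : ℕ) (hN : 2 ≤ N) (q : ℝ) (x y : Fin N → Fin 2) :
    depolarize N q (fun x y => GHZ N x * (starRingEnd ℂ) (GHZ N y)) x y =
      1 / 2 * ∑ p : Fin 2 × Fin 2, ∏ i, depolarizedUnit q p.1 p.2 (x i) (y i) := by
  simp_rw [GHZ_mul_conj N hN]
  rw [depolarize_mul_sum]
  congr 1
  refine Finset.sum_congr rfl fun p _ => ?_
  rw [depolarize_prod N q (fun a b => (if a = p.1 then 1 else 0) * if b = p.2 then 1 else 0)]
  simp [depolarizedUnit, eq_comm (a := p.2) (b := p.1)]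

theorem prod_glue {N : ℕ} (hN : 2 ≤ N) (a b : Fin 2 → Fin 2) (z w : Fin (N - 2) → Fin 2)
    (f : Fin 2 → Fin 2 → ℂ) :
    ∏ i, f (glue N a z i) (glue N b w i) =
      f (a 0) (b 0) * f (a 1) (b 1) * ∏ i, f (z i) (w i) := by
  obtain ⟨n, rfl⟩ := Nat.exists_eq_add_of_le' hN
  rw [Fin.prod_univ_succ, Fin.prod_univ_succ, ← mul_assoc]
  rfl

/-- Splitting an `N`-qubit string into its first two and its last `N - 2` coordinates. -/
def glueEquiv (N : ℕ) (hN : 2 ≤ N) :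
    (Fin 2 → Fin 2) × (Fin (N - 2) → Fin 2) ≃ (Fin N → Fin 2) where
  toFun p := glue N p.1 p.2
  invFun x := (fun j => x (Fin.castLE hN j), fun j => x ⟨j + 2, by omega⟩)
  left_inv p := by
    refine Prod.ext (funext fun j => ?_) (funext fun j => ?_)
    · exact dif_pos j.isLt
    · simp [glue]
  right_inv x := by
    funext j
    simp only [glue]
    split_ifs with h
    · rfl
    · exact congrArg x (Fin.ext (by simp; omega))

theorem sum_eq_sum_glue {N : ℕ} (hN : 2 ≤ N) (F : (Fin N → Fin 2) → ℂ) :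
    ∑ x, F x = ∑ a, ∑ z, F (glue N a z) := by
  rw [← (glueEquiv N hN).sum_comp, Fintype.sum_prod_type]
  rfl

theorem sum_sum_prod {n : ℕ} (f : Fin 2 → Fin 2 → ℂ) :
    ∑ z : Fin n → Fin 2, ∑ w : Fin n → Fin 2, ∏ i, f (z i) (w i) = (∑ c, ∑ d, f c d) ^ n := by
  have h (z : Fin n → Fin 2) : ∑ w : Fin n → Fin 2, ∏ i, f (z i) (w i) = ∏ i, ∑ d, f (z i) d :=
    (Fintype.prod_sum fun i d => f (z i) d).symm
  simp_rw [h]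
  rw [← Fintype.prod_sum fun (_ : Fin n) c => ∑ d, f c d]
  simp

theorem sum_depolarizedUnit (q : ℝ) (s t : Fin 2) :
    ∑ c, ∑ d, depolarizedUnit q s t c d = if s = t then 1 else (q : ℂ) := by
  fin_cases s <;> fin_cases t <;> simp [depolarizedUnit, Fin.sum_univ_two] <;> ring

/-- The unnormalized state on the first two qubits after measuring `|+⟩` on the others. -/
theorem sum_sum_depolarize_GHZ {N : ℕ} (hN : 2 ≤ N) (q : ℝ) (a b : Fin 2 → Fin 2) :
    ∑ z, ∑ w, depolarize N q (fun x y => GHZ N x * (starRingEnd ℂ) (GHZ N y))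
        (glue N a z) (glue N b w) =
      1 / 2 * ∑ s : Fin 2, ∑ t : Fin 2, depolarizedUnit q s t (a 0) (b 0) *
        depolarizedUnit q s t (a 1) (b 1) * (if s = t then 1 else (q : ℂ)) ^ (N - 2) := by
  simp_rw [depolarize_GHZ N hN, prod_glue hN, ← Finset.mul_sum]
  congr 1
  refine (Finset.sum_congr rfl fun z _ => Finset.sum_comm).trans (Finset.sum_comm.trans ?_)
  rw [Fintype.sum_prod_type]
  refine Finset.sum_congr rfl fun s _ => Finset.sum_congr rfl fun t _ => ?_
  simp_rw [← Finset.mul_sum]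
  rw [sum_sum_prod, sum_depolarizedUnit]

theorem sum_fin_two_arrow (F : Fin 2 → Fin 2 → ℂ) :
    ∑ a : Fin 2 → Fin 2, F (a 0) (a 1) = ∑ c, ∑ d, F c d := by
  rw [← Fintype.sum_prod_type', ← (finTwoArrowEquiv (Fin 2)).sum_comp]
  rfl

theorem sum_phiPlus_mul (F : Fin 2 → Fin 2 → ℂ) :
    ∑ a : Fin 2 → Fin 2, phiPlus a * F (a 0) (a 1) =
      ((1 / Real.sqrt 2 : ℝ) : ℂ) * (F 0 0 + F 1 1) := by
  unfold phiPlus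
  rw [sum_fin_two_arrow fun c d => (if (c = 0 ∧ d = 0) ∨ (c = 1 ∧ d = 1) then
    ((1 / Real.sqrt 2 : ℝ) : ℂ) else 0) * F c d]
  simp [Fin.sum_univ_two, mul_add]

theorem phiPlusExt_glue {N : ℕ} (hN : 2 ≤ N) (a : Fin 2 → Fin 2) (z : Fin (N - 2) → Fin 2) :
    phiPlusExt N hN (glue N a z) = ((1 / Real.sqrt (2 ^ (N - 2)) : ℝ) : ℂ) * phiPlus a := by
  rw [mul_comm]
  rfl

theorem conj_phiPlus (a : Fin 2 → Fin 2) : (starRingEnd ℂ) (phiPlus a) = phiPlus a := by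
  unfold phiPlus
  split_ifs <;> simp

theorem inner_phiPlusExt_depolarize_GHZ {N : ℕ} (hN : 2 ≤ N) (q : ℝ) :
    ∑ x : Fin N → Fin 2, ∑ y : Fin N → Fin 2,
        (starRingEnd ℂ) (phiPlusExt N hN x) *
          depolarize N q (fun x y => GHZ N x * (starRingEnd ℂ) (GHZ N y)) x y *
          phiPlusExt N hN y =
      1 / (2 : ℂ) ^ (N - 2) * ((2 * q ^ N + q ^ 2 + 1) / 4) := by
  have hc : ((1 / Real.sqrt (2 ^ (N - 2)) : ℝ) : ℂ) * ((1 / Real.sqrt (2 ^ (N - 2)) : ℝ) : ℂ) =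
      1 / 2 ^ (N - 2) := by
    rw [← Complex.ofReal_mul, div_mul_div_comm, Real.mul_self_sqrt (by positivity)]
    simp
  have hsum : ∑ x : Fin N → Fin 2, ∑ y : Fin N → Fin 2,
        (starRingEnd ℂ) (phiPlusExt N hN x) *
          depolarize N q (fun x y => GHZ N x * (starRingEnd ℂ) (GHZ N y)) x y *
          phiPlusExt N hN y =
      1 / (2 : ℂ) ^ (N - 2) * ∑ a, phiPlus a * ∑ b, phiPlus b *
        ∑ z, ∑ w, depolarize N q (fun x y => GHZ N x * (starRingEnd ℂ) (GHZ N y))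
          (glue N a z) (glue N b w) := by
    rw [sum_eq_sum_glue hN]
    simp_rw [sum_eq_sum_glue hN, phiPlusExt_glue, map_mul, Complex.conj_ofReal, conj_phiPlus,
      ← hc, Finset.mul_sum]
    refine Finset.sum_congr rfl fun a _ => ?_
    rw [Finset.sum_comm]
    refine Finset.sum_congr rfl fun b _ => Finset.sum_congr rfl fun z _ =>
      Finset.sum_congr rfl fun w _ => ?_
    ring
  rw [hsum]
  congr 1
  simp_rw [sum_sum_depolarize_GHZ hN]
  have hb (a : Fin 2 → Fin 2) := sum_phiPlus_mul fun b₀ b₁ =>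
    1 / 2 * ∑ s : Fin 2, ∑ t : Fin 2, depolarizedUnit q s t (a 0) b₀ *
      depolarizedUnit q s t (a 1) b₁ * (if s = t then 1 else (q : ℂ)) ^ (N - 2)
  simp_rw [hb]
  rw [sum_phiPlus_mul fun a₀ a₁ => ((1 / Real.sqrt 2 : ℝ) : ℂ) *
    ((1 / 2 * ∑ s : Fin 2, ∑ t : Fin 2, depolarizedUnit q s t a₀ 0 *
      depolarizedUnit q s t a₁ 0 * (if s = t then 1 else (q : ℂ)) ^ (N - 2)) +
    (1 / 2 * ∑ s : Fin 2, ∑ t : Fin 2, depolarizedUnit q s t a₀ 1 *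
      depolarizedUnit q s t a₁ 1 * (if s = t then 1 else (q : ℂ)) ^ (N - 2))),
    ← mul_add, ← mul_assoc, inv_sqrt_two_mul_self]
  have hpow : (q : ℂ) ^ N = q ^ (N - 2) * q ^ 2 := by rw [← pow_add, Nat.sub_add_cancel hN]
  rw [hpow]
  simp [Fin.sum_univ_two, depolarizedUnit]
  ring

theorem trace_depolarize_GHZ {N : ℕ} (hN : 2 ≤ N) (q : ℝ) :
    ∑ a : Fin 2 → Fin 2, ∑ z : Fin (N - 2) → Fin 2, ∑ w : Fin (N - 2) → Fin 2,
        depolarize N q (fun x y => GHZ N x * (starRingEnd ℂ) (GHZ N y))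
            (glue N a z) (glue N a w) *
          (1 / (2 : ℂ) ^ (N - 2)) =
      1 / (2 : ℂ) ^ (N - 2) := by
  simp_rw [← Finset.sum_mul, sum_sum_depolarize_GHZ hN]
  rw [sum_fin_two_arrow fun a₀ a₁ => 1 / 2 * ∑ s : Fin 2, ∑ t : Fin 2,
    depolarizedUnit q s t a₀ a₀ * depolarizedUnit q s t a₁ a₁ *
      (if s = t then 1 else (q : ℂ)) ^ (N - 2)]
  simp [Fin.sum_univ_two, depolarizedUnit]
  ring

/-- Under N-fold depolarizing noise, the fidelity of the anonymous
entanglement produced by the GHZ-state protocol equals (2q^N + q² + 1)/4: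
⟨v, ρ v⟩ / Tr[ρ·(1⊗P₊)] with ρ = 𝒟_q^{⊗N}(|G_N⟩⟨G_N|) and v = φ⁺ ⊗ |+…+⟩. -/
theorem GHZ_depolarizing_fidelity (N : ℕ) (hN : 2 ≤ N)
    (q : ℝ) (hq : q ∈ Set.Icc (0 : ℝ) 1) :
    (∑ x : Fin N → Fin 2, ∑ y : Fin N → Fin 2,
        (starRingEnd ℂ) (phiPlusExt N hN x) *
          depolarize N q (fun x y => GHZ N x * (starRingEnd ℂ) (GHZ N y)) x y *
          phiPlusExt N hN y)
      /
    (∑ a : Fin 2 → Fin 2, ∑ z : Fin (N - 2) → Fin 2, ∑ w : Fin (N - 2) → Fin 2,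
        depolarize N q (fun x y => GHZ N x * (starRingEnd ℂ) (GHZ N y))
            (glue N a z) (glue N a w) *
          (1 / (2 : ℂ) ^ (N - 2)))
    = (((2 * q ^ N + q ^ 2 + 1) / 4 : ℝ) : ℂ) := by
  rw [inner_phiPlusExt_depolarize_GHZ hN, trace_depolarize_GHZ hN,
    mul_div_cancel_left₀ _ (one_div_ne_zero (pow_ne_zero _ two_ne_zero))]
  push_cast
  rfl
end

section
/- For every N ≥ 2, every q ∈ [0,1], and every outcome string s : Fin (N−2) → Fin 2, the probability of obtaining outcome s when the last N−2 qubits of the dephased GHZ state 𝒫_q^{⊗N}(|G_N⟩⟨G_N|) are measured in the X basis equals 2^{−(N−2)}, independently of s and of q. Precisely, Tr[𝒫_q^{⊗N}(|G_N⟩⟨G_N|)·(1⊗|s_X⟩⟨s_X|)] = 2^{−(N−2)}, i.e. all X-basis measurement outcomes are equally likely. -/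
open Finset

/-- The m-qubit X-basis vector |s_X⟩: amplitude on z is
2^{−m/2}·(−1)^{Σ_i s_i z_i}. -/
noncomputable def xBasis (m : ℕ) (s z : Fin m → Fin 2) : ℂ :=
  ((1 / Real.sqrt (2 ^ m) : ℝ) : ℂ) * (-1) ^ (∑ i, (s i : ℕ) * (z i : ℕ))

/-- A glued string is constant iff its first two coordinates agree and all the others equal them. -/
lemma glue_const_iff (N : ℕ) (hN : 2 ≤ N) (a : Fin 2 → Fin 2) (z : Fin (N - 2) → Fin 2) :
    (∀ i j : Fin N, glue N a z i = glue N a z j) ↔ a 0 = a 1 ∧ z = fun _ => a 0 := by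
  constructor
  · intro h
    refine ⟨?_, funext fun k => ?_⟩
    · simpa [glue] using h ⟨0, by omega⟩ ⟨1, by omega⟩
    · simpa [glue] using h ⟨k + 2, by omega⟩ ⟨0, by omega⟩
  · rintro ⟨h, rfl⟩
    have ha : ∀ k : Fin 2, a k = a 0 := by
      intro k
      fin_cases k
      · rfl
      · exact h.symm
    have key : ∀ i : Fin N, glue N a (fun _ => a 0) i = a 0 := by
      intro i
      unfold glue
      split_ifs
      · exact ha _
      · rfl
    intro i j
    rw [key, key]

lemma GHZ_glue (N : ℕ) (hN : 2 ≤ N) (a : Fin 2 → Fin 2) (z : Fin (N - 2) → Fin 2) :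
    GHZ N (glue N a z) =
      if a 0 = a 1 ∧ z = fun _ => a 0 then ((1 / Real.sqrt 2 : ℝ) : ℂ) else 0 := by
  simp only [GHZ, glue_const_iff N hN]

lemma xBasis_mul_conj (m : ℕ) (s z : Fin m → Fin 2) :
    xBasis m s z * (starRingEnd ℂ) (xBasis m s z) = ((2 : ℂ) ^ m)⁻¹ := by
  have h : (1 / Real.sqrt (2 ^ m)) * (1 / Real.sqrt (2 ^ m)) = ((2 : ℝ) ^ m)⁻¹ := by
    rw [div_mul_div_comm, Real.mul_self_sqrt (by positivity), one_mul, one_div]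
  have hs (k : ℕ) : (-1 : ℂ) ^ k * (-1) ^ k = 1 := by
    rw [← mul_pow]
    simp
  simp only [xBasis, map_mul, map_pow, map_neg, map_one, Complex.conj_ofReal]
  rw [mul_mul_mul_comm, hs, mul_one, ← Complex.ofReal_mul, h]
  push_cast
  rfl

/-- For the dephased GHZ state, every X-basis outcome s on the last N−2 qubits
is equally likely: Tr[𝒫_q^{⊗N}(|G_N⟩⟨G_N|)·(1⊗|s_X⟩⟨s_X|)] = 2^{−(N−2)},
independently of s and of q. -/
theorem GHZ_dephased_X_outcomes_uniform (N : ℕ) (hN : 2 ≤ N)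
    (q : ℝ) (hq : q ∈ Set.Icc (0 : ℝ) 1) (s : Fin (N - 2) → Fin 2) :
    (∑ a : Fin 2 → Fin 2, ∑ x : Fin (N - 2) → Fin 2, ∑ y : Fin (N - 2) → Fin 2,
        dephase N q (fun x y => GHZ N x * (starRingEnd ℂ) (GHZ N y))
            (glue N a x) (glue N a y) *
          xBasis (N - 2) s y * (starRingEnd ℂ) (xBasis (N - 2) s x))
    = ((2 : ℂ) ^ (N - 2))⁻¹ := by
  have hr : ((1 / Real.sqrt 2 : ℝ) : ℂ) * ((1 / Real.sqrt 2 : ℝ) : ℂ) = 1 / 2 := by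
    rw [← Complex.ofReal_mul, div_mul_div_comm, Real.mul_self_sqrt (by norm_num)]
    norm_num
  have inner (a : Fin 2 → Fin 2) :
      (∑ x : Fin (N - 2) → Fin 2, ∑ y : Fin (N - 2) → Fin 2,
        dephase N q (fun x y => GHZ N x * (starRingEnd ℂ) (GHZ N y))
            (glue N a x) (glue N a y) *
          xBasis (N - 2) s y * (starRingEnd ℂ) (xBasis (N - 2) s x))
      = if a 0 = a 1 then 1 / 2 * ((2 : ℂ) ^ (N - 2))⁻¹ else 0 := by
    simp only [dephase, GHZ_glue N hN]
    split_ifs with h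
    · rw [Fintype.sum_eq_single (fun _ => a 0), Fintype.sum_eq_single (fun _ => a 0)]
      · rw [if_pos ⟨h, rfl⟩, Complex.conj_ofReal, hr, hammingDist_self, mul_assoc,
          xBasis_mul_conj]
        simp
      · intro y hy
        simp [hy]
      · intro x hx
        simp [hx]
    · simp [h]
  simp only [inner]
  rw [← Finset.sum_filter, Finset.sum_const,
    show #{a : Fin 2 → Fin 2 | a 0 = a 1} = 2 by decide]
  simp
end
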